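/- arXiv:2110.03985 — 2 statements merged into one kernel-verified Lean document; each statement's English description precedes it below -/
import Mathlib

section
/- Let n ≥ 2 be an integer. Let r₀, r₁ : ℝ → ℝ be functions such that for every d < 0: r₀(d) > 0 and sinh(r₀(d))^(n-1) + (n-1)·I_{n-1}(r₀(d)) + d = 0, and r₁(d) > 0 and (n-1)·I_{n-1}(r₁(d)) + d = 0. Then r₀(d)/r₁(d) tends to 0 as d tends to 0 from the left. -/
/-- `I_m(t) = ∫₀^t sinh(τ)^m dτ`. -/
noncomputable def Ifun (m : ℕ) (t : ℝ) : ℝ := ∫ τ in (0:ℝ)..t, Real.sinh τ ^ m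

lemma pow_div_le_Ifun (m : ℕ) {r : ℝ} (hr : 0 ≤ r) :
    r ^ (m + 1) / ((m : ℝ) + 1) ≤ Ifun m r := by
  have h : ∫ τ in (0 : ℝ)..r, τ ^ m = r ^ (m + 1) / ((m : ℝ) + 1) := by
    simp [integral_pow]
  rw [← h]
  refine intervalIntegral.integral_mono_on hr ((continuous_pow m).intervalIntegrable 0 r)
    ((Real.continuous_sinh.pow m).intervalIntegrable 0 r) fun τ hτ => ?_
  exact pow_le_pow_left₀ hτ.1 (Real.self_le_sinh_iff.2 hτ.1) m

lemma Ifun_le_mul_sinh_pow (m : ℕ) {r : ℝ} (hr : 0 ≤ r) :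
    Ifun m r ≤ r * Real.sinh r ^ m := by
  have h : ∫ _ in (0 : ℝ)..r, Real.sinh r ^ m = r * Real.sinh r ^ m := by simp
  rw [← h]
  refine intervalIntegral.integral_mono_on hr ((Real.continuous_sinh.pow m).intervalIntegrable 0 r)
    (continuous_const.intervalIntegrable 0 r) fun τ hτ => ?_
  exact pow_le_pow_left₀ (Real.sinh_nonneg_iff.2 hτ.1) (Real.sinh_le_sinh.2 hτ.2) m

lemma sinh_le_two_mul {r : ℝ} (hr : 0 ≤ r) (hr1 : r ≤ 1) : Real.sinh r ≤ 2 * r := by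
  have h := (abs_le.1 (Real.abs_exp_sub_one_sub_id_le (abs_le.2 ⟨by linarith, hr1⟩))).2
  have h' := Real.add_one_le_exp (-r)
  rw [Real.sinh_eq]
  nlinarith

open Filter in
lemma tendsto_zero_of_pow_tendsto_zero {α : Type*} {l : Filter α} {f : α → ℝ} {m : ℕ}
    (hf : ∀ᶠ x in l, 0 ≤ f x)
    (h : Tendsto (fun x => f x ^ m) l (nhds 0)) : Tendsto f l (nhds 0) := by
  refine tendsto_order.2 ⟨fun a ha => hf.mono fun x hx => ha.trans_le hx, fun ε hε => ?_⟩
  filter_upwards [h.eventually_lt_const (pow_pos hε m)] with x hx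
  exact lt_of_pow_lt_pow_left₀ m hε.le hx

/-- For `n ≥ 2`, with `r₀(d) = r_{0,d}` and `r₁(d) = r_{1,d}` as in the paper,
`r₀(d)/r₁(d) → 0` as `d → 0⁻`. -/
theorem statement14 (n : ℕ) (hn : 2 ≤ n) (r₀ r₁ : ℝ → ℝ)
    (h₀ : ∀ d : ℝ, d < 0 → 0 < r₀ d ∧
      Real.sinh (r₀ d) ^ (n - 1) + ((n : ℝ) - 1) * Ifun (n - 1) (r₀ d) + d = 0)
    (h₁ : ∀ d : ℝ, d < 0 →
      0 < r₁ d ∧ ((n : ℝ) - 1) * Ifun (n - 1) (r₁ d) + d = 0) :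
    Filter.Tendsto (fun d : ℝ => r₀ d / r₁ d) (nhdsWithin 0 (Set.Iio 0)) (nhds 0) := by
  obtain ⟨m, rfl⟩ : ∃ m, n = m + 1 := ⟨n - 1, by omega⟩
  have hm0 : (0 : ℝ) < m := by exact_mod_cast (by omega : 0 < m)
  simp only [Nat.add_sub_cancel, Nat.cast_add, Nat.cast_one, add_sub_cancel_right] at h₀ h₁
  have hneg : ∀ᶠ d : ℝ in nhdsWithin 0 (Set.Iio 0), d < 0 := self_mem_nhdsWithin
  have hd : Filter.Tendsto (fun d : ℝ => d) (nhdsWithin 0 (Set.Iio 0)) (nhds 0) :=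
    tendsto_nhdsWithin_of_tendsto_nhds Filter.tendsto_id
  have hr₁ : Filter.Tendsto r₁ (nhdsWithin 0 (Set.Iio 0)) (nhds 0) := by
    refine tendsto_zero_of_pow_tendsto_zero (m := m + 1)
      (hneg.mono fun d hd => (h₁ d hd).1.le) ?_
    refine squeeze_zero' (g := fun d => -((m + 1) / m : ℝ) * d)
      (hneg.mono fun d hd => pow_nonneg (h₁ d hd).1.le _) (hneg.mono fun d hd => ?_)
      (by simpa using hd.const_mul (-((m + 1) / m : ℝ)))
    obtain ⟨hpos, heq⟩ := h₁ d hd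
    have hI := (div_le_iff₀ (by positivity)).1 (pow_div_le_Ifun m hpos.le)
    have hd' : d = -(m * Ifun m (r₁ d)) := by linarith
    calc r₁ d ^ (m + 1) ≤ Ifun m (r₁ d) * (m + 1) := hI
      _ = -((m + 1) / m : ℝ) * -(m * Ifun m (r₁ d)) := by field_simp
      _ = -((m + 1) / m : ℝ) * d := by rw [← hd']
  refine tendsto_zero_of_pow_tendsto_zero (m := m)
    (hneg.mono fun d hd => (div_pos (h₀ d hd).1 (h₁ d hd).1).le) ?_
  refine squeeze_zero' (g := fun d => (m * 2 ^ m : ℝ) * r₁ d)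
    (hneg.mono fun d hd => pow_nonneg (div_pos (h₀ d hd).1 (h₁ d hd).1).le _) ?_
    (by simpa using hr₁.const_mul (m * 2 ^ m : ℝ))
  filter_upwards [hneg, hr₁.eventually_lt_const one_pos] with d hd hlt
  obtain ⟨hpos₀, heq₀⟩ := h₀ d hd
  obtain ⟨hpos₁, heq₁⟩ := h₁ d hd
  have hI₀ : 0 ≤ Ifun m (r₀ d) := le_trans (by positivity) (pow_div_le_Ifun m hpos₀.le)
  rw [div_pow, div_le_iff₀ (pow_pos hpos₁ m)]
  calc r₀ d ^ m ≤ Real.sinh (r₀ d) ^ m :=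
        pow_le_pow_left₀ hpos₀.le (Real.self_le_sinh_iff.2 hpos₀.le) m
    _ ≤ m * Ifun m (r₁ d) := by linarith [mul_nonneg hm0.le hI₀]
    _ ≤ m * (r₁ d * Real.sinh (r₁ d) ^ m) := by
        gcongr
        exact Ifun_le_mul_sinh_pow m hpos₁.le
    _ ≤ m * (r₁ d * (2 * r₁ d) ^ m) := by
        gcongr
        exact sinh_le_two_mul hpos₁.le hlt.le
    _ = m * 2 ^ m * r₁ d * r₁ d ^ m := by rw [mul_pow]; ring
end

section
/- Let n ≥ 2 be an integer and let H > (n-1)/n be a real number, and let R_C > 0 be the unique positive solution of cosh(ρ)^(n-1) = n·H·J_{n-1}(ρ). Then the function t ↦ nH·J_{n-1}(t)/√(cosh(t)^(2n-2) − (nH·J_{n-1}(t))²) is integrable on the interval [0, R_C); in particular h_C := lim_{ρ → R_C⁻} μ_{H,0}(ρ) exists and is finite, where μ_{H,0}(ρ) = ∫₀^ρ nH·J_{n-1}(t)/√(cosh(t)^(2n-2) − (nH·J_{n-1}(t))²) dt. -/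
/-- `J_m(t) = ∫₀^t cosh(τ)^m dτ`. -/
noncomputable def Jfun (m : ℕ) (t : ℝ) : ℝ := ∫ τ in (0:ℝ)..t, Real.cosh τ ^ m

/-- The generating curve `μ_{H,0}` of the horizontal CMC `H` cylinder. -/
noncomputable def mu (n : ℕ) (H ρ : ℝ) : ℝ :=
  ∫ t in (0:ℝ)..ρ,
    (n : ℝ) * H * Jfun (n - 1) t /
      Real.sqrt (Real.cosh t ^ (2 * n - 2) - ((n : ℝ) * H * Jfun (n - 1) t) ^ 2)

theorem continuous_cosh_pow (m : ℕ) : Continuous fun τ : ℝ => Real.cosh τ ^ m :=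
  Real.continuous_cosh.pow m

theorem hasDerivAt_Jfun (m : ℕ) (t : ℝ) : HasDerivAt (Jfun m) (Real.cosh t ^ m) t :=
  intervalIntegral.integral_hasDerivAt_right ((continuous_cosh_pow m).intervalIntegrable _ _)
    (continuous_cosh_pow m).stronglyMeasurable.stronglyMeasurableAtFilter
    (continuous_cosh_pow m).continuousAt

theorem continuous_Jfun (m : ℕ) : Continuous (Jfun m) :=
  continuous_iff_continuousAt.2 fun t => (hasDerivAt_Jfun m t).continuousAt

theorem Jfun_nonneg (m : ℕ) {t : ℝ} (ht : 0 ≤ t) : 0 ≤ Jfun m t :=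
  intervalIntegral.integral_nonneg ht fun u _ => pow_nonneg (Real.cosh_pos u).le m

theorem Jfun_monotone (m : ℕ) : Monotone (Jfun m) :=
  monotone_of_hasDerivAt_nonneg (hasDerivAt_Jfun m) fun t => pow_nonneg (Real.cosh_pos t).le m

/-- The function `cosh ^ m - K * J_m` decreases with slope at most `-(K - m)`. -/
theorem antitone_cosh_pow_sub_Jfun_add (m : ℕ) {K : ℝ} (hK : (m : ℝ) ≤ K) :
    Antitone fun t : ℝ => Real.cosh t ^ m - K * Jfun m t + (K - m) * t := by
  refine antitone_of_hasDerivAt_nonpos (fun t =>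
    (((Real.hasDerivAt_cosh t).pow m).sub ((hasDerivAt_Jfun m t).const_mul K)).add
      ((hasDerivAt_id t).const_mul (K - m))) fun t => ?_
  have h1 : (1 : ℝ) ≤ Real.cosh t ^ m := one_le_pow₀ (Real.one_le_cosh t)
  have h2 : (m : ℝ) * Real.cosh t ^ (m - 1) * Real.sinh t ≤ m * Real.cosh t ^ m := by
    rcases m with _ | k
    · simp
    · rw [mul_assoc, Nat.add_sub_cancel, pow_succ (Real.cosh t) k]
      have := (Real.sinh_lt_cosh t).le
      have := Real.cosh_pos t
      gcongr
  simp only [mul_one, Pi.zero_apply]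
  nlinarith [mul_nonneg (sub_nonneg.2 hK) (sub_nonneg.2 h1)]

theorem integrableOn_inv_sqrt_sub (R : ℝ) :
    MeasureTheory.IntegrableOn (fun t : ℝ => (Real.sqrt (R - t))⁻¹) (Set.Ico 0 R) := by
  rcases le_or_gt R 0 with hR | hR
  · simp [Set.Ico_eq_empty_of_le hR]
  have h := (intervalIntegral.intervalIntegrable_rpow' (a := 0) (b := R)
    (show (-1 : ℝ) < -(1 / 2) by norm_num)).comp_sub_left R
  rw [sub_zero, sub_self] at h
  have h' := (intervalIntegrable_iff_integrableOn_Ico_of_le hR.le).1 h.symm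
  refine h'.congr_fun (fun t ht => ?_) measurableSet_Ico
  simp only
  rw [Real.rpow_neg (sub_nonneg.2 ht.2.le), Real.sqrt_eq_rpow]

theorem integrableOn_cylinder_integrand (m : ℕ) {K R : ℝ} (hK : (m : ℝ) < K)
    (hR : Real.cosh R ^ m = K * Jfun m R) :
    MeasureTheory.IntegrableOn
      (fun t : ℝ => K * Jfun m t / Real.sqrt (Real.cosh t ^ (2 * m) - (K * Jfun m t) ^ 2))
      (Set.Ico 0 R) := by
  have hK0 : 0 ≤ K := (Nat.cast_nonneg m).trans hK.le
  refine MeasureTheory.Integrable.mono'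
    ((integrableOn_inv_sqrt_sub R).const_mul (K * Jfun m R * (Real.sqrt (K - m))⁻¹)) ?_ ?_
  · have hJ := (continuous_Jfun m).measurable
    have hc := Real.continuous_cosh.measurable
    exact ((hJ.const_mul K).div
      ((hc.pow_const _).sub ((hJ.const_mul K).pow_const 2)).sqrt).aestronglyMeasurable
  · refine (MeasureTheory.ae_restrict_iff' measurableSet_Ico).2 (Filter.Eventually.of_forall ?_)
    rintro t ⟨ht0, htR⟩
    have hJ : 0 ≤ K * Jfun m t := mul_nonneg hK0 (Jfun_nonneg m ht0)
    have hslope : (K - m) * (R - t) ≤ Real.cosh t ^ m - K * Jfun m t := by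
      have := antitone_cosh_pow_sub_Jfun_add m hK.le htR.le
      simp only at this
      linarith
    have hpos : 0 < (K - m) * (R - t) := mul_pos (sub_pos.2 hK) (sub_pos.2 htR)
    have hc : (1 : ℝ) ≤ Real.cosh t ^ m := one_le_pow₀ (Real.one_le_cosh t)
    have hrad : (K - m) * (R - t) ≤ Real.cosh t ^ (2 * m) - (K * Jfun m t) ^ 2 := by
      rw [mul_comm 2 m, pow_mul, sq_sub_sq]
      nlinarith
    rw [Real.norm_of_nonneg (by positivity), mul_assoc, ← mul_inv,
      ← Real.sqrt_mul (sub_pos.2 hK).le, ← div_eq_mul_inv]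
    have hmono := Jfun_monotone m htR.le
    have hnum : 0 ≤ K * Jfun m R := hJ.trans (by gcongr)
    gcongr

/-- For `n ≥ 2`, `H > (n-1)/n`, with `R_C` the unique positive solution of
`cosh(ρ)^(n-1) = n·H·J_{n-1}(ρ)`, the integrand of `μ_{H,0}` is integrable on `[0, R_C)`;
in particular the height `h_C = lim_{ρ → R_C⁻} μ_{H,0}(ρ)` exists and is finite. -/
theorem statement19 (n : ℕ) (hn : 2 ≤ n) (H : ℝ) (hH : H > ((n : ℝ) - 1) / n)
    (RC : ℝ) (hRC : 0 < RC)
    (heq : Real.cosh RC ^ (n - 1) = (n : ℝ) * H * Jfun (n - 1) RC)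
    (huniq : ∀ ρ : ℝ, 0 < ρ →
      Real.cosh ρ ^ (n - 1) = (n : ℝ) * H * Jfun (n - 1) ρ → ρ = RC) :
    MeasureTheory.IntegrableOn
      (fun t : ℝ => (n : ℝ) * H * Jfun (n - 1) t /
        Real.sqrt (Real.cosh t ^ (2 * n - 2) - ((n : ℝ) * H * Jfun (n - 1) t) ^ 2))
      (Set.Ico 0 RC) ∧
    ∃ hC : ℝ, Filter.Tendsto (mu n H) (nhdsWithin RC (Set.Iio RC)) (nhds hC) := by
  obtain ⟨m, rfl⟩ : ∃ m, n = m + 1 := ⟨n - 1, by omega⟩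
  have hK : (m : ℝ) < ((m + 1 : ℕ) : ℝ) * H := by
    have := (div_lt_iff₀ (by positivity)).1 hH
    push_cast at this ⊢
    linarith
  have hint := integrableOn_cylinder_integrand m hK heq
  refine ⟨hint, mu (m + 1) H RC, ?_⟩
  have hcont := intervalIntegral.continuousOn_primitive_interval
    (a := 0) (b := RC) (μ := MeasureTheory.volume) (by
      rw [Set.uIcc_of_le hRC.le]
      exact (integrableOn_Icc_iff_integrableOn_Ico).2 hint)
  rw [Set.uIcc_of_le hRC.le] at hcont
  have htend := (hcont RC (Set.right_mem_Icc.2 hRC.le)).mono Set.Ioo_subset_Icc_self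
  rw [ContinuousWithinAt, nhdsWithin_Ioo_eq_nhdsLT hRC] at htend
  exact htend
end
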